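/- Convex decision monotonicity over a fixed decision range (correctness of the divide-and-conquer interval split): let w satisfy the convex quadrangle inequality, let E : ℕ → ℝ, and fix j_l ≤ j_r. For each i > j_r define m(i) as the least j ∈ [j_l, j_r] minimizing E(j) + w(j,i). Then m is nondecreasing in i; in particular, if i_m > j_r and j_m = m(i_m), then m(i) ∈ [j_l, j_m] for every j_r < i < i_m and m(i) ∈ [j_m, j_r] for every i > i_m. -/

import Mathlib

/-- **Convex decision monotonicity over a fixed decision range**
(correctness of the divide-and-conquer interval split).
Let `w` satisfy the convex quadrangle inequality, fix a decision range
`[jl, jr]`, and for `i > jr` let `m i` be the least `j ∈ [jl, jr]` minimizing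
`E j + w j i`.  Then `m` is nondecreasing; in particular, for `im > jr`,
`m i ∈ [jl, m im]` for every `jr < i < im`, and `m i ∈ [m im, jr]` for every
`i > im`. -/
theorem convex_dm_interval_split (w : ℕ → ℕ → ℝ)
    (hw : ∀ a b c d : ℕ, a ≤ b → b ≤ c → c ≤ d → w a c + w b d ≤ w a d + w b c)
    (E : ℕ → ℝ) (jl jr : ℕ) (hjlr : jl ≤ jr) (m : ℕ → ℕ)
    (hm : ∀ i : ℕ, jr < i →
      (jl ≤ m i ∧ m i ≤ jr) ∧
      (∀ j : ℕ, jl ≤ j → j ≤ jr → E (m i) + w (m i) i ≤ E j + w j i) ∧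
      (∀ j : ℕ, jl ≤ j → j < m i → E (m i) + w (m i) i < E j + w j i)) :
    (∀ i i' : ℕ, jr < i → i ≤ i' → m i ≤ m i') ∧
    (∀ im : ℕ, jr < im →
      (∀ i : ℕ, jr < i → i < im → jl ≤ m i ∧ m i ≤ m im) ∧
      (∀ i : ℕ, im < i → m im ≤ m i ∧ m i ≤ jr)) := by
  have mono : ∀ i i' : ℕ, jr < i → i ≤ i' → m i ≤ m i' := by
    intro i i' hi hii'
    by_contra! hlt
    obtain ⟨⟨hl, hr⟩, -, hleast⟩ := hm i hi
    obtain ⟨⟨hl', -⟩, hmin', -⟩ := hm i' (hi.trans_le hii')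
    have h₁ := hw (m i') (m i) i i' hlt.le (hr.trans hi.le) hii'
    have h₂ := hleast (m i') hl' hlt
    have h₃ := hmin' (m i) hl hr
    linarith
  exact ⟨mono, fun im him =>
    ⟨fun i hi hlt => ⟨(hm i hi).1.1, mono i im hi hlt.le⟩,
      fun i hlt => ⟨mono im i him hlt.le, (hm i (him.trans hlt)).1.2⟩⟩⟩
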